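/- arXiv:1601.01032 — 7 statements merged into one kernel-verified Lean document; each statement's English description precedes it below -/
import Mathlib

section
/- Let v₁, v₂, v₃, v₄ be four vectors in the Euclidean plane ℝ² with ‖vᵢ‖ = 1 for i = 1,2,3,4 and v₁ + v₂ + v₃ + v₄ = 0. Then there exist indices i ≠ j such that vᵢ = −vⱼ. -/
lemma opp_aux (a b c d : ℝ) (h1 : a^2+b^2=1) (h2 : c^2+d^2=1) (h : 1 + (a*c+b*d) = 0) :
    a = -c ∧ b = -d := by
  have h3 : (a+c)^2 + (b+d)^2 = 0 := by linarith
  have h4 : (a+c)^2 = 0 := by nlinarith [sq_nonneg (a+c), sq_nonneg (b+d)]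
  have h5 : (b+d)^2 = 0 := by nlinarith [sq_nonneg (a+c), sq_nonneg (b+d)]
  have h6 := pow_eq_zero_iff (two_ne_zero) |>.1 h4
  have h7 := pow_eq_zero_iff (two_ne_zero) |>.1 h5
  constructor <;> linarith

/-- Four unit vectors in the Euclidean plane summing to zero must contain a
pair of opposite vectors. -/
theorem four_unit_vectors_sum_zero_opposite_pair
    (v : Fin 4 → EuclideanSpace ℝ (Fin 2))
    (hnorm : ∀ i, ‖v i‖ = 1)
    (hsum : v 0 + v 1 + v 2 + v 3 = 0) :
    ∃ i j : Fin 4, i ≠ j ∧ v i = -v j := by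
  have hn : ∀ i, (v i 0)^2 + (v i 1)^2 = 1 := by
    intro i
    have h := EuclideanSpace.real_norm_sq_eq (v i)
    rw [hnorm i, Fin.sum_univ_two] at h
    linarith
  have s0 : v 0 0 + v 1 0 + v 2 0 + v 3 0 = 0 := by
    simpa using congrArg (fun w : EuclideanSpace ℝ (Fin 2) => w 0) hsum
  have s1 : v 0 1 + v 1 1 + v 2 1 + v 3 1 = 0 := by
    simpa using congrArg (fun w : EuclideanSpace ℝ (Fin 2) => w 1) hsum
  have key : ∀ i j : Fin 4, i ≠ j → 1 + (v i 0 * v j 0 + v i 1 * v j 1) = 0 →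
      ∃ i j : Fin 4, i ≠ j ∧ v i = -v j := by
    intro i j hij h
    obtain ⟨p, q⟩ := opp_aux _ _ _ _ (hn i) (hn j) h
    refine ⟨i, j, hij, ?_⟩
    ext k
    fin_cases k
    · simpa using p
    · simpa using q
  have e0 := hn 0
  have e1 := hn 1
  have e2 := hn 2
  have e3 := hn 3
  have k01 := key 0 1 (by decide)
  have k12 := key 1 2 (by decide)
  have k02 := key 0 2 (by decide)
  generalize v 0 0 = a at *
  generalize v 0 1 = b at *
  generalize v 1 0 = c at *
  generalize v 1 1 = d at *
  generalize v 2 0 = e at *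
  generalize v 2 1 = f at *
  have t0 : v 3 0 = -(a+c+e) := by linarith
  have t1 : v 3 1 = -(b+d+f) := by linarith
  rw [t0, t1] at e3
  have g : (a^2+b^2)*(c^2+d^2)*(e^2+f^2) + 2*(a*c+b*d)*(c*e+d*f)*(a*e+b*f)
      - (a^2+b^2)*(c*e+d*f)^2 - (c^2+d^2)*(a*e+b*f)^2 - (e^2+f^2)*(a*c+b*d)^2 = 0 := by ring
  have hs : (a*c+b*d) + (c*e+d*f) + (a*e+b*f) = -1 := by linarith
  rw [e0, e1, e2] at g
  generalize a*c+b*d = x at *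
  generalize c*e+d*f = y at *
  generalize a*e+b*f = z at *
  have hp : (1+x)*(1+y)*(1+z) = 0 := by
    have : z = -1 - x - y := by linarith
    subst this
    linarith
  rcases mul_eq_zero.1 hp with h | h
  · rcases mul_eq_zero.1 h with h | h
    · exact k01 h
    · exact k12 h
  · exact k02 h
end

section
/- Let μₙ (n ∈ ℕ) and μ be finite Borel measures on Sⁿ such that μₙ → μ weakly, i.e. ∫ f dμₙ → ∫ f dμ for every continuous function f : Sⁿ → ℝ. Then for every continuous compactly supported function g : ℝ^{n+1} → ℝ one has ∫ g dC_k(μₙ) → ∫ g dC_k(μ). That is, the cone construction is continuous from weak convergence of finite measures on the sphere to weak convergence (tested against compactly supported continuous functions) of the cone measures. -/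
open MeasureTheory Metric Set Filter

/-- The cone measure over a measure `μ` on the unit sphere `Sⁿ ⊆ ℝ^{n+1}`:
the pushforward, under `(τ, x) ↦ τ • x`, of the product of the measure with
density `τ ↦ τ^k` with respect to Lebesgue measure on `(0, ∞)` with `μ`. -/
noncomputable def coneMeasure (n k : ℕ)
    (μ : Measure (sphere (0 : EuclideanSpace ℝ (Fin (n + 1))) 1)) :
    Measure (EuclideanSpace ℝ (Fin (n + 1))) :=
  Measure.map
    (fun p : ℝ × sphere (0 : EuclideanSpace ℝ (Fin (n + 1))) 1 =>
      p.1 • (p.2 : EuclideanSpace ℝ (Fin (n + 1))))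
    ((((volume : Measure ℝ).restrict (Ioi (0 : ℝ))).withDensity
        (fun τ => ENNReal.ofReal (τ ^ k))).prod μ)

/-- The cone construction is continuous from weak convergence of finite
measures on the sphere to weak convergence (tested against compactly supported
continuous functions) of the cone measures. -/
theorem coneMeasure_continuous (n k : ℕ) (hn : 1 ≤ n)
    (μs : ℕ → Measure (sphere (0 : EuclideanSpace ℝ (Fin (n + 1))) 1))
    (μ : Measure (sphere (0 : EuclideanSpace ℝ (Fin (n + 1))) 1))
    [∀ m, IsFiniteMeasure (μs m)] [IsFiniteMeasure μ]
    (hconv : ∀ f : sphere (0 : EuclideanSpace ℝ (Fin (n + 1))) 1 → ℝ,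
      Continuous f →
        Tendsto (fun m => ∫ x, f x ∂(μs m)) atTop (nhds (∫ x, f x ∂μ)))
    (g : EuclideanSpace ℝ (Fin (n + 1)) → ℝ)
    (hg : Continuous g) (hgsupp : HasCompactSupport g) :
    Tendsto (fun m => ∫ y, g y ∂(coneMeasure n k (μs m))) atTop
      (nhds (∫ y, g y ∂(coneMeasure n k μ))) := by
  set ν : Measure ℝ := ((volume : Measure ℝ).restrict (Ioi (0 : ℝ))).withDensity
        (fun τ => ENNReal.ofReal (τ ^ k)) with hν
  haveI : IsLocallyFiniteMeasure ν :=
    IsLocallyFiniteMeasure.withDensity_ofReal (continuous_pow k)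
  obtain ⟨R, hR⟩ := hgsupp.isCompact.isBounded.subset_closedBall 0
  have hzero : ∀ (τ : ℝ) (x : sphere (0 : EuclideanSpace ℝ (Fin (n + 1))) 1),
      τ ∉ Icc (-R) R → g (τ • (x : EuclideanSpace ℝ (Fin (n + 1)))) = 0 := by
    intro τ x hτ
    by_contra h
    apply hτ
    have h1 := hR (subset_tsupport g h)
    have hx : ‖(x : EuclideanSpace ℝ (Fin (n + 1)))‖ = 1 := by simp
    rw [mem_closedBall_zero_iff, norm_smul, hx, mul_one, Real.norm_eq_abs] at h1
    exact abs_le.1 h1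
  have hc : Continuous (fun p : ℝ × sphere (0 : EuclideanSpace ℝ (Fin (n + 1))) 1 =>
      p.1 • (p.2 : EuclideanSpace ℝ (Fin (n + 1)))) := by fun_prop
  have key : ∀ (ρ : Measure (sphere (0 : EuclideanSpace ℝ (Fin (n + 1))) 1))
      [IsFiniteMeasure ρ], ∫ y, g y ∂(coneMeasure n k ρ) =
        ∫ x, (∫ τ in Icc (-R) R, g (τ • (x : EuclideanSpace ℝ (Fin (n + 1)))) ∂ν) ∂ρ := by
    intro ρ _
    unfold coneMeasure
    rw [← hν, integral_map hc.aemeasurable hg.aestronglyMeasurable]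
    rw [integral_prod_symm]
    · refine integral_congr_ae (Eventually.of_forall fun x => ?_)
      exact (setIntegral_eq_integral_of_forall_compl_eq_zero fun τ hτ => hzero τ x hτ).symm
    · apply (hg.comp hc).integrable_of_hasCompactSupport
      refine HasCompactSupport.intro ((isCompact_Icc (a := -R) (b := R)).prod isCompact_univ) ?_
      rintro ⟨τ, x⟩ h
      exact hzero τ x fun h' => h ⟨h', mem_univ _⟩
  rw [key μ]
  simp_rw [fun m => key (μs m)]
  apply hconv
  exact continuous_parametric_integral_of_continuous
    (f := fun (x : sphere (0 : EuclideanSpace ℝ (Fin (n + 1))) 1) (τ : ℝ) =>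
      g (τ • (x : EuclideanSpace ℝ (Fin (n + 1)))))
    (hg.comp (hc.comp continuous_swap)) isCompact_Icc
end

section
/- Let μ be a finite Borel measure on Sⁿ, k ≥ 0 an integer, and ν = C_k(μ) the cone measure. Then the support of ν equals {λ • x : λ ≥ 0, x ∈ supp μ}, where the support of a Borel measure is the set of points all of whose open neighborhoods have positive measure. Equivalently: a point y ∈ ℝ^{n+1} satisfies ν(U) > 0 for every open set U containing y if and only if y = λ • x for some λ ≥ 0 and some x in the support of μ. -/
open MeasureTheory Metric Set

/-- The support of the cone measure is the cone over the support of `μ`: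
a point `y` has the property that every open neighborhood has positive cone
measure if and only if `y = λ • x` for some `λ ≥ 0` and `x` in the support
of `μ`. -/
theorem coneMeasure_support (n k : ℕ) (hn : 1 ≤ n)
    (μ : Measure (sphere (0 : EuclideanSpace ℝ (Fin (n + 1))) 1))
    [IsFiniteMeasure μ]
    (y : EuclideanSpace ℝ (Fin (n + 1))) :
    (∀ U : Set (EuclideanSpace ℝ (Fin (n + 1))), IsOpen U → y ∈ U →
        0 < coneMeasure n k μ U) ↔
      ∃ lam : ℝ, 0 ≤ lam ∧
        ∃ x : sphere (0 : EuclideanSpace ℝ (Fin (n + 1))) 1,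
          (∀ V : Set (sphere (0 : EuclideanSpace ℝ (Fin (n + 1))) 1),
              IsOpen V → x ∈ V → 0 < μ V) ∧
          y = lam • (x : EuclideanSpace ℝ (Fin (n + 1))) := by
  have hcont : Continuous (fun p : ℝ × sphere (0 : EuclideanSpace ℝ (Fin (n + 1))) 1 =>
      p.1 • (p.2 : EuclideanSpace ℝ (Fin (n + 1)))) := by fun_prop
  have hfm : Measurable (fun τ : ℝ => ENNReal.ofReal (τ ^ k)) := by fun_prop
  have hsupp : ∀ x, x ∈ μ.support ↔
      ∀ V : Set (sphere (0 : EuclideanSpace ℝ (Fin (n + 1))) 1),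
              IsOpen V → x ∈ V → 0 < μ V := by
    intro x
    rw [Measure.mem_support_iff_forall]
    constructor
    · intro h V hV hx
      exact h V (hV.mem_nhds hx)
    · intro h U hU
      obtain ⟨V, hVU, hV, hx⟩ := _root_.mem_nhds_iff.1 hU
      exact (h V hV hx).trans_le (measure_mono hVU)
  simp only [← hsupp]
  constructor
  · intro h
    let K : Set (EuclideanSpace ℝ (Fin (n + 1)) ×
        sphere (0 : EuclideanSpace ℝ (Fin (n + 1))) 1) :=
      {p | p.1 = ‖p.1‖ • (p.2 : EuclideanSpace ℝ (Fin (n + 1)))} ∩ {p | p.2 ∈ μ.support}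
    have hK : IsClosed K := by
      apply IsClosed.inter
      · exact isClosed_eq (by fun_prop) (by fun_prop)
      · exact Measure.isClosed_support.preimage continuous_snd
    have hC : IsClosed (Prod.fst '' K) := isClosedMap_fst_of_compactSpace _ hK
    by_cases hy : y ∈ Prod.fst '' K
    · obtain ⟨⟨y', x⟩, ⟨h1, h2⟩, rfl⟩ := hy
      exact ⟨‖y'‖, norm_nonneg _, x, h2, h1⟩
    · exfalso
      refine (h _ hC.isOpen_compl hy).ne' ?_
      rw [coneMeasure, Measure.map_apply hcont.measurable hC.isOpen_compl.measurableSet]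
      refine measure_mono_null (t := (Iio 0 ×ˢ univ) ∪ (univ ×ˢ μ.supportᶜ)) ?_ ?_
      · rintro ⟨τ, x⟩ hp
        by_contra hq
        simp only [mem_union, mem_prod, mem_Iio, mem_univ, and_true, true_and, mem_compl_iff,
          not_or, not_lt, not_not] at hq
        refine hp ⟨(τ • (x : EuclideanSpace ℝ (Fin (n + 1))), x), ⟨?_, hq.2⟩, rfl⟩
        simp [norm_smul, abs_of_nonneg hq.1]
      · refine measure_union_null ?_ ?_
        · rw [Measure.prod_prod, withDensity_apply _ measurableSet_Iio,
            Measure.restrict_restrict measurableSet_Iio]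
          have : Iio (0 : ℝ) ∩ Ioi 0 = ∅ := by
            ext t; simp; intro h; exact h.le
          simp [this]
        · rw [Measure.prod_prod, Measure.measure_compl_support, mul_zero]
  · rintro ⟨l, hl, x, hx, rfl⟩ U hU hy
    rw [coneMeasure, Measure.map_apply hcont.measurable hU.measurableSet]
    obtain ⟨A, V, hA, hV, hlA, hxV, hAV⟩ :=
      isOpen_prod_iff.1 (hU.preimage hcont) l x hy
    refine lt_of_lt_of_le ?_ (measure_mono hAV)
    rw [Measure.prod_prod]
    refine ENNReal.mul_pos ?_ ((hsupp x).1 hx V hV hxV).ne'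
    intro h0
    rw [withDensity_apply_eq_zero hfm] at h0
    rw [Measure.restrict_apply' measurableSet_Ioi] at h0
    have hne : (A ∩ Ioi 0).Nonempty := by
      have : l ∈ closure (Ioi (0 : ℝ)) := by rw [closure_Ioi]; exact hl
      exact mem_closure_iff.1 this A hA hlA
    refine ((hA.inter isOpen_Ioi).measure_pos volume hne).ne' (measure_mono_null ?_ h0)
    rintro t ⟨htA, ht⟩
    refine ⟨⟨?_, htA⟩, ht⟩
    have : 0 < t ^ k := pow_pos ht k
    simpa using this
end

section
/- Let μ be a finite Borel measure on Sⁿ, k ≥ 0 an integer, and ν = C_k(μ) the cone measure. Then for every y ∈ ℝ^{n+1} and every r > ‖y‖, ((r − ‖y‖)^{k+1}/(k+1)) · μ(Sⁿ) ≤ ν(B(y, r)) ≤ ((r + ‖y‖)^{k+1}/(k+1)) · μ(Sⁿ), where B(y, r) is the open ball of radius r centered at y. -/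
open MeasureTheory Metric Set

theorem coneAux_radial (k : ℕ) (s : ℝ) (hs : 0 ≤ s) (A : Set ℝ) (hA : MeasurableSet A)
    (h : A ∩ Ioi 0 = Ioo 0 s) :
    (((volume : Measure ℝ).restrict (Ioi (0 : ℝ))).withDensity
        (fun τ => ENNReal.ofReal (τ ^ k))) A = ENNReal.ofReal (s ^ (k + 1) / (k + 1)) := by
  rw [withDensity_apply _ hA, Measure.restrict_restrict hA, h,
    ← ofReal_integral_eq_lintegral_ofReal]
  · rw [← integral_Ioc_eq_integral_Ioo, ← intervalIntegral.integral_of_le hs, integral_pow]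
    simp
  · exact ((continuous_pow k).integrableOn_Icc (a := 0) (b := s)).mono_set Ioo_subset_Icc_self
  · filter_upwards [ae_restrict_mem measurableSet_Ioo] with x hx
    exact pow_nonneg hx.1.le k

/-- Two-sided bounds for the cone measure of a ball `B(y, r)` with
`r > ‖y‖`. -/
theorem coneMeasure_ball_bounds (n k : ℕ) (hn : 1 ≤ n)
    (μ : Measure (sphere (0 : EuclideanSpace ℝ (Fin (n + 1))) 1))
    [IsFiniteMeasure μ]
    (y : EuclideanSpace ℝ (Fin (n + 1))) (r : ℝ) (hr : ‖y‖ < r) :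
    ENNReal.ofReal ((r - ‖y‖) ^ (k + 1) / (k + 1)) * μ univ ≤
        coneMeasure n k μ (ball y r) ∧
      coneMeasure n k μ (ball y r) ≤
        ENNReal.ofReal ((r + ‖y‖) ^ (k + 1) / (k + 1)) * μ univ := by
  have hm : Measurable (fun p : ℝ × sphere (0 : EuclideanSpace ℝ (Fin (n + 1))) 1 =>
      p.1 • (p.2 : EuclideanSpace ℝ (Fin (n + 1)))) :=
    (by fun_prop : Continuous _).measurable
  have hy := norm_nonneg y
  have hx : ∀ (t : ℝ) (x : sphere (0 : EuclideanSpace ℝ (Fin (n + 1))) 1),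
      ‖t • (x : EuclideanSpace ℝ (Fin (n + 1)))‖ = |t| := by
    intro t x
    rw [norm_smul, norm_eq_of_mem_sphere, mul_one, Real.norm_eq_abs]
  rw [coneMeasure, Measure.map_apply hm measurableSet_ball]
  constructor
  · rw [← coneAux_radial k (r - ‖y‖) (by linarith) (Ioo 0 (r - ‖y‖)) measurableSet_Ioo
      (by ext t; simp; tauto), ← Measure.prod_prod]
    apply measure_mono
    rintro ⟨t, x⟩ ⟨ht, -⟩
    simp only [mem_preimage, mem_ball, dist_eq_norm]
    have h1 := norm_sub_le (t • (x : EuclideanSpace ℝ (Fin (n + 1)))) y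
    rw [hx, abs_of_pos ht.1] at h1
    have := ht.2
    simp only at this
    linarith
  · rw [← coneAux_radial k (r + ‖y‖) (by linarith) (Iio (r + ‖y‖)) measurableSet_Iio
      (by ext t; simp; tauto), ← Measure.prod_prod]
    apply measure_mono
    rintro ⟨t, x⟩ ht
    simp only [mem_preimage, mem_ball, dist_eq_norm] at ht
    refine ⟨?_, mem_univ _⟩
    have h1 := norm_sub_norm_le (t • (x : EuclideanSpace ℝ (Fin (n + 1)))) y
    rw [hx] at h1
    have := le_abs_self t
    simp only [mem_Iio]
    linarith
end

section
/- Let μ be a finite Borel measure on Sⁿ, k ≥ 0 an integer, and ν = C_k(μ) the cone measure. Then for every y ∈ ℝ^{n+1}, the limit as r → ∞ of (k+1) · ν(B(y, r)) / r^{k+1} exists and equals μ(Sⁿ). In other words, the total mass of μ can be recovered from the asymptotic (k+1)-dimensional density of the cone measure at infinity, based at any point. -/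
open MeasureTheory Metric Set Filter

lemma coneMeasure_ball_zero (n k : ℕ)
    (μ : Measure (sphere (0 : EuclideanSpace ℝ (Fin (n + 1))) 1))
    [IsFiniteMeasure μ] (r : ℝ) (hr : 0 ≤ r) :
    coneMeasure n k μ (ball 0 r) = ENNReal.ofReal (r ^ (k + 1) / (k + 1)) * μ univ := by
  have hm : Measurable (fun p : ℝ × sphere (0 : EuclideanSpace ℝ (Fin (n + 1))) 1 =>
      p.1 • (p.2 : EuclideanSpace ℝ (Fin (n + 1)))) := by
    apply Continuous.measurable
    fun_prop
  have hpre : (fun p : ℝ × sphere (0 : EuclideanSpace ℝ (Fin (n + 1))) 1 =>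
      p.1 • (p.2 : EuclideanSpace ℝ (Fin (n + 1)))) ⁻¹' ball 0 r = Ioo (-r) r ×ˢ univ := by
    ext ⟨t, x⟩
    have hx : ‖(x : EuclideanSpace ℝ (Fin (n + 1)))‖ = 1 := by simp
    simp only [mem_preimage, mem_ball_zero_iff, norm_smul, hx, mul_one, Real.norm_eq_abs,
      abs_lt, mem_prod, mem_Ioo, mem_univ, and_true]
  rw [coneMeasure, Measure.map_apply hm measurableSet_ball, hpre, Measure.prod_prod]
  congr 1
  rw [withDensity_apply _ measurableSet_Ioo, Measure.restrict_restrict measurableSet_Ioo]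
  have hset : Ioo (-r) r ∩ Ioi 0 = Ioo 0 r := by
    ext t
    simp only [mem_inter_iff, mem_Ioo, mem_Ioi]
    constructor
    · rintro ⟨⟨_, h⟩, h'⟩; exact ⟨h', h⟩
    · rintro ⟨h, h'⟩; exact ⟨⟨by linarith, h'⟩, h⟩
  rw [hset, ← ofReal_integral_eq_lintegral_ofReal]
  · rw [← integral_Ioc_eq_integral_Ioo, ← intervalIntegral.integral_of_le hr, integral_pow]
    simp
  · exact ((continuous_pow k).integrableOn_Icc (a := 0) (b := r)).mono_set Ioo_subset_Icc_self
  · filter_upwards [ae_restrict_mem measurableSet_Ioo] with t ht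
    exact pow_nonneg ht.1.le k

/-- The total mass of `μ` is recovered from the asymptotic `(k+1)`-dimensional
density of the cone measure at infinity, based at any point. -/
theorem coneMeasure_density_at_infinity (n k : ℕ) (hn : 1 ≤ n)
    (μ : Measure (sphere (0 : EuclideanSpace ℝ (Fin (n + 1))) 1))
    [IsFiniteMeasure μ]
    (y : EuclideanSpace ℝ (Fin (n + 1))) :
    Tendsto
      (fun r : ℝ =>
        (k + 1 : ℝ) * (coneMeasure n k μ (ball y r)).toReal / r ^ (k + 1))
      atTop (nhds (μ univ).toReal) := by
  have hk : (0 : ℝ) < k + 1 := by positivity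
  have hlim : ∀ a : ℝ, Tendsto (fun r : ℝ => (1 + a / r) ^ (k + 1) * (μ univ).toReal)
      atTop (nhds (μ univ).toReal) := by
    intro a
    have h1 : Tendsto (fun r : ℝ => a / r) atTop (nhds 0) := tendsto_const_nhds.div_atTop tendsto_id
    simpa using ((h1.const_add 1).pow (k + 1)).mul_const (μ univ).toReal
  have hval : ∀ s : ℝ, 0 ≤ s → (coneMeasure n k μ (ball 0 s)).toReal
      = s ^ (k + 1) / (k + 1) * (μ univ).toReal := by
    intro s hs
    rw [coneMeasure_ball_zero n k μ s hs, ENNReal.toReal_mul, ENNReal.toReal_ofReal (by positivity)]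
  have hfin : ∀ s : ℝ, 0 ≤ s → coneMeasure n k μ (ball 0 s) ≠ ⊤ := by
    intro s hs
    rw [coneMeasure_ball_zero n k μ s hs]
    exact ENNReal.mul_ne_top ENNReal.ofReal_ne_top (measure_ne_top _ _)
  have key : ∀ a r : ℝ, 0 < r → 0 ≤ r + a → (1 + a / r) ^ (k + 1) * (μ univ).toReal
      = (k + 1 : ℝ) * (coneMeasure n k μ (ball 0 (r + a))).toReal / r ^ (k + 1) := by
    intro a r hr hra
    rw [hval _ hra, show 1 + a / r = (r + a) / r by field_simp, div_pow]
    field_simp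
  refine tendsto_of_tendsto_of_tendsto_of_le_of_le' (hlim (-‖y‖)) (hlim ‖y‖) ?_ ?_
  · filter_upwards [eventually_gt_atTop 0, eventually_ge_atTop ‖y‖] with r hr hry
    have hsub : ball (0 : EuclideanSpace ℝ (Fin (n + 1))) (r + -‖y‖) ⊆ ball y r :=
      ball_subset_ball' (by simp)
    have hsub2 : ball y r ⊆ ball (0 : EuclideanSpace ℝ (Fin (n + 1))) (r + ‖y‖) :=
      ball_subset_ball' (by simp)
    have hf := ne_top_of_le_ne_top (hfin (r + ‖y‖) (by positivity)) (measure_mono hsub2)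
    rw [key _ r hr (by linarith)]
    have := ENNReal.toReal_mono hf (measure_mono hsub)
    gcongr
  · filter_upwards [eventually_gt_atTop 0] with r hr
    have hsub2 : ball y r ⊆ ball (0 : EuclideanSpace ℝ (Fin (n + 1))) (r + ‖y‖) :=
      ball_subset_ball' (by simp)
    rw [key _ r hr (by positivity)]
    have := ENNReal.toReal_mono (hfin (r + ‖y‖) (by positivity)) (measure_mono hsub2)
    gcongr
end

section
/- Let μ be a finite Borel measure on Sⁿ, k ≥ 0 an integer, and ν = C_k(μ) the cone measure. Let h : ℝ^{n+1} → ℝ be a continuously differentiable function whose support is compact and contained in ℝ^{n+1} ∖ {0}. Then ∫ (⟨∇h(y), y⟩ + (k+1) · h(y)) dν(y) = 0, where ∇h(y) denotes the gradient of h at y and ⟨·,·⟩ the Euclidean inner product. (This expresses that the cone measure is stationary under the radial deformations generated by the vector field y ↦ h(y)·y.) -/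
open MeasureTheory Metric Set RealInnerProductSpace

/-- The cone measure is stationary under the radial deformations generated by
the vector field `y ↦ h(y) • y`, for `h` of class `C¹` with compact support
away from the origin. -/
theorem coneMeasure_radial_first_variation (n k : ℕ) (hn : 1 ≤ n)
    (μ : Measure (sphere (0 : EuclideanSpace ℝ (Fin (n + 1))) 1))
    [IsFiniteMeasure μ]
    (h : EuclideanSpace ℝ (Fin (n + 1)) → ℝ)
    (hC1 : ContDiff ℝ 1 h) (hsupp : HasCompactSupport h)
    (h0 : (0 : EuclideanSpace ℝ (Fin (n + 1))) ∉ tsupport h) :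
    ∫ y, (⟪gradient h y, y⟫ + (k + 1 : ℝ) * h y) ∂(coneMeasure n k μ) = 0 := by
  have hdiff : Differentiable ℝ h := hC1.differentiable one_ne_zero
  have hG : ∀ y, ⟪gradient h y, y⟫ = fderiv ℝ h y y := by
    intro y
    simp [gradient]
  simp_rw [hG]
  have hcont : Continuous (fun y => fderiv ℝ h y y + (k + 1 : ℝ) * h y) := by
    have h1 : Continuous (fderiv ℝ h) := hC1.continuous_fderiv one_ne_zero
    have h2 : Continuous h := hC1.continuous
    exact (h1.clm_apply continuous_id).add (continuous_const.mul h2)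
  have hmap : Continuous (fun p : ℝ × sphere (0 : EuclideanSpace ℝ (Fin (n + 1))) 1 =>
      p.1 • (p.2 : EuclideanSpace ℝ (Fin (n + 1)))) := by fun_prop
  unfold coneMeasure
  rw [integral_map hmap.measurable.aemeasurable hcont.aestronglyMeasurable]
  by_cases hI : Integrable (fun p : ℝ × sphere (0 : EuclideanSpace ℝ (Fin (n + 1))) 1 =>
      fderiv ℝ h (p.1 • (p.2 : EuclideanSpace ℝ (Fin (n + 1))))
        (p.1 • (p.2 : EuclideanSpace ℝ (Fin (n + 1))))
        + (k + 1 : ℝ) * h (p.1 • (p.2 : EuclideanSpace ℝ (Fin (n + 1)))))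
      ((((volume : Measure ℝ).restrict (Ioi (0 : ℝ))).withDensity
        (fun τ => ENNReal.ofReal (τ ^ k))).prod μ)
  swap
  · exact integral_undef hI
  rw [integral_prod_symm _ hI]
  refine integral_eq_zero_of_ae (Filter.Eventually.of_forall fun x => ?_)
  simp only [Pi.zero_apply]
  rw [integral_withDensity_eq_integral_toReal_smul (by fun_prop)
    (Filter.Eventually.of_forall fun τ => ENNReal.ofReal_lt_top)]
  have hcongr : ∀ τ ∈ Ioi (0 : ℝ), (ENNReal.ofReal (τ ^ k)).toReal •
      (fderiv ℝ h (τ • (x : EuclideanSpace ℝ (Fin (n + 1)))) (τ • (x : EuclideanSpace ℝ (Fin (n + 1))))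
        + (k + 1 : ℝ) * h (τ • (x : EuclideanSpace ℝ (Fin (n + 1)))))
      = ((k + 1 : ℝ) * τ ^ k) * h (τ • (x : EuclideanSpace ℝ (Fin (n + 1))))
        + τ ^ (k + 1) * fderiv ℝ h (τ • (x : EuclideanSpace ℝ (Fin (n + 1)))) x := by
    intro τ hτ
    rw [ENNReal.toReal_ofReal (pow_nonneg (le_of_lt hτ) k), map_smul]
    simp only [smul_eq_mul]
    ring
  rw [setIntegral_congr_fun measurableSet_Ioi hcongr]
  by_cases hJ : IntegrableOn (fun τ : ℝ =>
      ((k + 1 : ℝ) * τ ^ k) * h (τ • (x : EuclideanSpace ℝ (Fin (n + 1))))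
        + τ ^ (k + 1) * fderiv ℝ h (τ • (x : EuclideanSpace ℝ (Fin (n + 1)))) x) (Ioi 0)
  swap
  · exact integral_undef hJ
  have hderiv : ∀ τ ∈ Ici (0 : ℝ), HasDerivAt
      (fun τ : ℝ => τ ^ (k + 1) * h (τ • (x : EuclideanSpace ℝ (Fin (n + 1)))))
      (((k + 1 : ℝ) * τ ^ k) * h (τ • (x : EuclideanSpace ℝ (Fin (n + 1))))
        + τ ^ (k + 1) * fderiv ℝ h (τ • (x : EuclideanSpace ℝ (Fin (n + 1)))) x) τ := by
    intro τ _
    have a : HasDerivAt (fun τ : ℝ => τ ^ (k + 1)) ((k + 1 : ℝ) * τ ^ k) τ := by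
      simpa using hasDerivAt_pow (k + 1) τ
    have b : HasDerivAt (fun τ : ℝ => τ • (x : EuclideanSpace ℝ (Fin (n + 1)))) x τ := by
      simpa using (hasDerivAt_id τ).smul_const (x : EuclideanSpace ℝ (Fin (n + 1)))
    exact a.mul ((hdiff _).hasFDerivAt.comp_hasDerivAt τ b)
  have htend : Filter.Tendsto
      (fun τ : ℝ => τ ^ (k + 1) * h (τ • (x : EuclideanSpace ℝ (Fin (n + 1)))))
      Filter.atTop (nhds 0) := by
    obtain ⟨R, hR⟩ := hsupp.isBounded.subset_closedBall (0 : EuclideanSpace ℝ (Fin (n + 1)))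
    refine tendsto_const_nhds.congr' ?_
    filter_upwards [Filter.eventually_gt_atTop R, Filter.eventually_gt_atTop 0] with τ h1 h2
    have hx : ‖(x : EuclideanSpace ℝ (Fin (n + 1)))‖ = 1 := by simp
    have : h (τ • (x : EuclideanSpace ℝ (Fin (n + 1)))) = 0 := by
      by_contra hne
      have h3 := hR (subset_tsupport h hne)
      rw [mem_closedBall_zero_iff, norm_smul, hx, Real.norm_of_nonneg h2.le] at h3
      linarith
    rw [this, mul_zero]
  rw [integral_Ioi_of_hasDerivAt_of_tendsto' hderiv hJ htend]
  simp
end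

section
/- Let q be a real polynomial in three variables of total degree at most 2, let u, v ∈ ℝ³ be orthonormal vectors, and define γ : ℝ → ℝ³ by γ(t) = (cos t) • u + (sin t) • v, a parametrization of a great circle of the unit sphere. If the function t ↦ q(γ(t)) is not identically zero, then the set {t ∈ [0, 2π) : q(γ(t)) = 0} is finite and has at most 4 elements. Consequently, a great circle of S² that is not contained in the zero set of q meets {x : q(x) = 0} in at most 4 points. -/
open Real Set RealInnerProductSpace

/-- The quadratic `z γ_i` as a polynomial in `z = exp (i t)`. -/
noncomputable def gcL (a b : ℝ) : Polynomial ℂ :=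
  Polynomial.C ((a : ℂ) / 2) * (Polynomial.X ^ 2 + Polynomial.C 1) +
    Polynomial.C (-(b : ℂ) * Complex.I / 2) * (Polynomial.X ^ 2 - Polynomial.C 1)

lemma gcL_deg (a b : ℝ) : (gcL a b).natDegree ≤ 2 := by
  unfold gcL
  compute_degree

lemma gcL_eval (a b t : ℝ) : (gcL a b).eval (Complex.exp (t * Complex.I)) =
    Complex.exp (t * Complex.I) * ((Real.cos t * a + Real.sin t * b : ℝ) : ℂ) := by
  have h : Complex.exp (t * Complex.I) = Complex.cos t + Complex.sin t * Complex.I :=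
    Complex.exp_mul_I _
  have hs := Complex.sin_sq_add_cos_sq (t : ℂ)
  have hI := Complex.I_sq
  simp only [gcL, Polynomial.eval_add, Polynomial.eval_mul, Polynomial.eval_sub,
    Polynomial.eval_C, Polynomial.eval_pow, Polynomial.eval_X, h]
  push_cast
  generalize Complex.cos (t : ℂ) = c at *
  generalize Complex.sin (t : ℂ) = s at *
  generalize Complex.I = I at *
  have h1 : (c + s * I) ^ 2 + 1 = 2 * c * (c + s * I) := by
    linear_combination s ^ 2 * hI - hs
  have h2 : (c + s * I) ^ 2 - 1 = 2 * s * I * (c + s * I) := by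
    linear_combination (-s ^ 2) * hI + hs
  rw [h1, h2]
  linear_combination (-(b : ℂ) * s * (c + s * I)) * hI

/-- The associated polynomial of degree at most 4. -/
noncomputable def gcP (q : MvPolynomial (Fin 3) ℝ) (a b : Fin 3 → ℝ) : Polynomial ℂ :=
  ∑ m ∈ q.support, Polynomial.C ((q.coeff m : ℝ) : ℂ) * Polynomial.X ^ (2 - ∑ i, m i) *
    ∏ i, gcL (a i) (b i) ^ m i

lemma gc_msum (q : MvPolynomial (Fin 3) ℝ) (hq : q.totalDegree ≤ 2)
    (m : Fin 3 →₀ ℕ) (hm : m ∈ q.support) : ∑ i, m i ≤ 2 := by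
  have := MvPolynomial.le_totalDegree hm
  rw [Finsupp.sum_fintype _ _ (fun _ => rfl)] at this
  exact this.trans hq

lemma gcP_deg (q : MvPolynomial (Fin 3) ℝ) (hq : q.totalDegree ≤ 2) (a b : Fin 3 → ℝ) :
    (gcP q a b).natDegree ≤ 4 := by
  apply Polynomial.natDegree_sum_le_of_forall_le
  intro m hm
  have h2 := gc_msum q hq m hm
  have h3 : (∏ i, gcL (a i) (b i) ^ m i).natDegree ≤ 2 * ∑ i, m i := by
    refine (Polynomial.natDegree_prod_le _ _).trans ?_
    rw [Finset.mul_sum]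
    refine Finset.sum_le_sum fun i _ => ?_
    refine Polynomial.natDegree_pow_le.trans ?_
    rw [mul_comm]
    exact Nat.mul_le_mul_right _ (gcL_deg _ _)
  have h4 := Polynomial.natDegree_C_mul_X_pow_le ((q.coeff m : ℝ) : ℂ) (2 - ∑ i, m i)
  refine Polynomial.natDegree_mul_le.trans ?_
  omega

lemma gcP_eval (q : MvPolynomial (Fin 3) ℝ) (hq : q.totalDegree ≤ 2) (a b : Fin 3 → ℝ) (t : ℝ) :
    (gcP q a b).eval (Complex.exp (t * Complex.I)) = Complex.exp (t * Complex.I) ^ 2 *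
      ((MvPolynomial.eval (fun i => Real.cos t * a i + Real.sin t * b i) q : ℝ) : ℂ) := by
  rw [MvPolynomial.eval_eq', gcP, Polynomial.eval_finset_sum, Complex.ofReal_sum, Finset.mul_sum]
  refine Finset.sum_congr rfl fun m hm => ?_
  have h2 := gc_msum q hq m hm
  simp only [Polynomial.eval_mul, Polynomial.eval_C, Polynomial.eval_pow, Polynomial.eval_X,
    Polynomial.eval_prod, gcL_eval, mul_pow, Finset.prod_mul_distrib, Finset.prod_pow_eq_pow_sum]
  rw [Complex.ofReal_mul, Complex.ofReal_prod]
  simp only [Complex.ofReal_pow]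
  generalize Complex.exp (t * Complex.I) = z
  have : z ^ 2 = z ^ (2 - ∑ i, m i) * z ^ (∑ i, m i) := by
    rw [← pow_add]; congr 1; omega
  rw [this]; ring

lemma gc_inj : InjOn (fun t : ℝ => Complex.exp (t * Complex.I)) (Ico 0 (2 * π)) := by
  intro s hs t ht h
  obtain ⟨n, hn⟩ := Complex.exp_eq_exp_iff_exists_int.1 h
  have h1 : s = t + n * (2 * π) := by
    have := congrArg Complex.im hn
    simpa using this
  have hp := Real.pi_pos
  have h3 : (n : ℝ) < 1 := by
    by_contra! hc
    nlinarith [hs.2, ht.1]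
  have h4 : (-1 : ℝ) < n := by
    by_contra! hc
    nlinarith [hs.1, ht.2]
  have h5 : n < 1 := by exact_mod_cast h3
  have h6 : -1 < n := by exact_mod_cast h4
  have : n = 0 := by omega
  simpa [this] using h1

/-- A great circle of `S²` not contained in the zero set of a polynomial `q`
of total degree at most 2 meets `{q = 0}` in at most 4 points. -/
theorem degree_two_poly_meets_great_circle (q : MvPolynomial (Fin 3) ℝ)
    (hq : q.totalDegree ≤ 2)
    (u v : EuclideanSpace ℝ (Fin 3))
    (hu : ‖u‖ = 1) (hv : ‖v‖ = 1) (huv : ⟪u, v⟫ = 0)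
    (γ : ℝ → EuclideanSpace ℝ (Fin 3))
    (hγ : ∀ t, γ t = Real.cos t • u + Real.sin t • v)
    (hnz : ¬ ∀ t : ℝ, MvPolynomial.eval (fun i => γ t i) q = 0) :
    {t ∈ Ico 0 (2 * π) | MvPolynomial.eval (fun i => γ t i) q = 0}.Finite ∧
      {t ∈ Ico 0 (2 * π) | MvPolynomial.eval (fun i => γ t i) q = 0}.ncard ≤ 4 := by
  have hg : ∀ t, (fun i => γ t i) = fun i => Real.cos t * u i + Real.sin t * v i := by
    intro t; funext i; rw [hγ]; simp
  have hev := fun t => gcP_eval q hq u v t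
  simp only [← hg] at hev
  have hP : gcP q u v ≠ 0 := by
    intro h0
    apply hnz
    intro t
    have := hev t
    rw [h0, Polynomial.eval_zero] at this
    simpa [Complex.exp_ne_zero] using this.symm
  set S := {t ∈ Ico 0 (2 * π) | MvPolynomial.eval (fun i => γ t i) q = 0} with hS
  have hmaps : ∀ t ∈ S, Complex.exp (t * Complex.I) ∈
      ((gcP q u v).roots.toFinset : Set ℂ) := by
    intro t ht
    have := hev t
    rw [ht.2] at this
    simp [hP, this]
  have hinj : InjOn (fun t : ℝ => Complex.exp (t * Complex.I)) S :=
    gc_inj.mono fun t ht => ht.1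
  refine ⟨Set.Finite.of_injOn hmaps hinj (Finset.finite_toSet _), ?_⟩
  refine (Set.ncard_le_ncard_of_injOn _ hmaps hinj (Finset.finite_toSet _)).trans ?_
  rw [Set.ncard_coe_finset]
  exact (Multiset.toFinset_card_le _).trans ((Polynomial.card_roots' _).trans (gcP_deg q hq u v))
end
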